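/- Moreover, when coprime p and q admit a p-solution and a q-solution of a linear system over ℚ, there exists an integral solution that is nonzero only on variables where the p-solution or the q-solution is nonzero. -/

import Mathlib

/-- A `p`-solution of a linear system: a solution in which every variable takes
value `0` or an integer power of `p`. This predicate captures the value condition. -/
def IsPPowValued (p : ℤ) {σ : Type*} (Φ : σ → ℚ) : Prop :=
  ∀ x, Φ x = 0 ∨ ∃ i : ℤ, Φ x = (p : ℚ) ^ i

theorem exists_pow_mul_int (p : ℤ) {σ : Type*} [Fintype σ] (Φ : σ → ℚ)
    (h : IsPPowValued p Φ) : ∃ N : ℕ, ∀ x, ∃ n : ℤ, (p : ℚ) ^ N * Φ x = n := by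
  have key : ∀ x, ∃ k : ℕ, ∀ N, k ≤ N → ∃ n : ℤ, (p : ℚ) ^ N * Φ x = n := by
    intro x
    rcases h x with h0 | ⟨i, hi⟩
    · exact ⟨0, fun N _ => ⟨0, by simp [h0]⟩⟩
    · obtain ⟨m, rfl | rfl⟩ := Int.eq_nat_or_neg i
      · exact ⟨0, fun N _ => ⟨p ^ N * p ^ m, by rw [hi]; push_cast; simp⟩⟩
      · refine ⟨m, fun N hN => ?_⟩
        obtain ⟨d, rfl⟩ := Nat.exists_eq_add_of_le hN
        rw [hi, zpow_neg, zpow_natCast]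
        by_cases hz : (p : ℚ) ^ m = 0
        · exact ⟨0, by simp [hz]⟩
        · exact ⟨p ^ d, by rw [pow_add]; push_cast; field_simp⟩
  choose k hk using key
  exact ⟨Finset.univ.sup k, fun x => hk x _ (Finset.le_sup (Finset.mem_univ x))⟩

/-- If coprime `p` and `q` admit a `p`-solution and a `q`-solution of a finite linear
system over `ℚ`, then there is an integral solution that is nonzero only on variables
where the `p`-solution or the `q`-solution is nonzero. -/
theorem p_q_solution_implies_integral_with_support
    {ι σ : Type*} [Fintype ι] [Fintype σ]
    (M : ι → σ → ℚ) (b : ι → ℚ) (p q : ℤ) (hpq : IsCoprime p q)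
    (Φp Φq : σ → ℚ)
    (hΦp : ∀ i, ∑ x, M i x * Φp x = b i)
    (hΦq : ∀ i, ∑ x, M i x * Φq x = b i)
    (hp : IsPPowValued p Φp) (hq : IsPPowValued q Φq) :
    ∃ Φ : σ → ℚ, (∀ i, ∑ x, M i x * Φ x = b i) ∧ (∀ x, ∃ n : ℤ, Φ x = (n : ℚ)) ∧
      (∀ x, Φ x ≠ 0 → (Φp x ≠ 0 ∨ Φq x ≠ 0)) := by
  obtain ⟨N, hN⟩ := exists_pow_mul_int p Φp hp
  obtain ⟨K, hK⟩ := exists_pow_mul_int q Φq hq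
  obtain ⟨u, v, huv⟩ := (hpq.pow : IsCoprime (p ^ N) (q ^ K))
  have huv' : (u : ℚ) * (p : ℚ) ^ N + v * (q : ℚ) ^ K = 1 := by exact_mod_cast huv
  refine ⟨fun x => u * ((p : ℚ) ^ N * Φp x) + v * ((q : ℚ) ^ K * Φq x), ?_, ?_, ?_⟩
  · intro i
    calc ∑ x, M i x * (u * ((p : ℚ) ^ N * Φp x) + v * ((q : ℚ) ^ K * Φq x))
        = (u * (p : ℚ) ^ N) * ∑ x, M i x * Φp x + (v * (q : ℚ) ^ K) * ∑ x, M i x * Φq x := by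
          rw [Finset.mul_sum, Finset.mul_sum, ← Finset.sum_add_distrib]
          exact Finset.sum_congr rfl fun x _ => by ring
      _ = b i := by rw [hΦp, hΦq, ← add_mul, huv', one_mul]
  · intro x
    obtain ⟨n, hn⟩ := hN x
    obtain ⟨m, hm⟩ := hK x
    exact ⟨u * n + v * m, by simp only [hn, hm]; push_cast; rfl⟩
  · intro x hx
    by_contra! hc
    exact hx (by simp [hc.1, hc.2])
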